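/- arXiv:0809.2034 — 2 statements merged into one kernel-verified Lean document; each statement's English description precedes it below -/
import Mathlib

section
/- The center of the braid group B₄ = ⟨a, b, c | aba = bab, bcb = cbc, ac = ca⟩ is the infinite cyclic subgroup generated by x⁴ = (bac)⁴; that is, the center of B₄ equals the subgroup of all integer powers of (bac)⁴, and (bac)⁴ has infinite order. -/
/-- Relators for the braid group `B₄ = ⟨a, b, c | aba = bab, bcb = cbc, ac = ca⟩`,
with generators indexed `0 ↦ a`, `1 ↦ b`, `2 ↦ c`. -/
def braidRels : Set (FreeGroup (Fin 3)) :=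
  { FreeGroup.of 0 * FreeGroup.of 1 * FreeGroup.of 0 *
      (FreeGroup.of 1 * FreeGroup.of 0 * FreeGroup.of 1)⁻¹,
    FreeGroup.of 1 * FreeGroup.of 2 * FreeGroup.of 1 *
      (FreeGroup.of 2 * FreeGroup.of 1 * FreeGroup.of 2)⁻¹,
    FreeGroup.of 0 * FreeGroup.of 2 * (FreeGroup.of 2 * FreeGroup.of 0)⁻¹ }

/-- The braid group on four strands. -/
abbrev B4 := PresentedGroup braidRels

namespace B4

def a : B4 := PresentedGroup.of 0
def b : B4 := PresentedGroup.of 1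
def c : B4 := PresentedGroup.of 2
def d : B4 := (a * c)⁻¹ * b * (a * c)
def e : B4 := a⁻¹ * b * a
def f : B4 := c⁻¹ * b * c
def x : B4 := b * a * c

end B4

open B4

theorem FreeGroup.center_eq_bot {α : Type*} [Nontrivial α] :
    Subgroup.center (FreeGroup α) = ⊥ := by
  classical
  rw [eq_bot_iff]
  intro w hw
  rw [Subgroup.mem_bot]
  by_contra hne
  obtain ⟨l, L, hL⟩ := List.exists_cons_of_ne_nil (mt FreeGroup.toWord_eq_nil_iff.1 hne)
  obtain ⟨j, hj⟩ := exists_ne l.1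
  have hl : (FreeGroup.of j * w).toWord = (j, true) :: w.toWord := by
    rw [FreeGroup.toWord_mul, FreeGroup.toWord_of, List.singleton_append, FreeGroup.reduce.cons,
      FreeGroup.reduce_toWord, hL]
    simp [hj]
  have hs := FreeGroup.toWord_mul_sublist w (FreeGroup.of j)
  rw [← Subgroup.mem_center_iff.1 hw, hl] at hs
  have h := hs.eq_of_length (by simp)
  rw [hL] at h
  simp only [List.cons_append, List.cons.injEq] at h
  exact hj (congrArg Prod.fst h.1)

theorem MulAut.conj_injective_of_center_eq_bot {F : Type*} [Group F]
    (hF : Subgroup.center F = ⊥) : Function.Injective (MulAut.conj : F →* MulAut F) := by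
  rw [injective_iff_map_eq_one]
  intro w hw
  rw [← Subgroup.mem_bot, ← hF, Subgroup.mem_center_iff]
  intro g
  have h := DFunLike.congr_fun hw g
  rw [MulAut.conj_apply, MulAut.one_apply, mul_inv_eq_iff_eq_mul] at h
  exact h.symm

theorem map_eq_one_of_mem_center {F G : Type*} [Group F] [Group G]
    (hF : Subgroup.center F = ⊥) {φ : G →* MulAut F} {ι : F →* G}
    (h : ∀ w, φ (ι w) = MulAut.conj w) {z : G} (hz : z ∈ Subgroup.center G) : φ z = 1 := by
  ext g
  apply MulAut.conj_injective_of_center_eq_bot hF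
  have hc := congrArg φ (Subgroup.mem_center_iff.1 hz (ι g))
  rw [map_mul, map_mul, h] at hc
  ext k
  have hk := DFunLike.congr_fun hc ((φ z)⁻¹ k)
  simp only [MulAut.mul_apply, MulAut.conj_apply, map_mul, map_inv, MulAut.apply_inv_self] at hk ⊢
  rw [← hk]
  simp

theorem map_apply_eq_conj_of_mem_closure {α G : Type*} [Group G]
    {φ : G →* MulAut (FreeGroup α)} {ι : FreeGroup α →* G} {s : Set G}
    (h : ∀ g ∈ s, ∀ i, ι (φ g (.of i)) = g * ι (.of i) * g⁻¹) {g : G}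
    (hg : g ∈ Subgroup.closure s) (w : FreeGroup α) : ι (φ g w) = g * ι w * g⁻¹ := by
  induction hg using Subgroup.closure_induction generalizing w with
  | mem g hg =>
    have hom : ι.comp (φ g).toMonoidHom = (MulAut.conj g).toMonoidHom.comp ι := by
      ext i
      exact h g hg i
    exact DFunLike.congr_fun hom w
  | one => simp
  | mul g k _ _ ihg ihk =>
    rw [map_mul, MulAut.mul_apply, ihg, ihk]
    group
  | inv g _ ih =>
    have := ih (φ g⁻¹ w)
    rw [map_inv, MulAut.apply_inv_self] at this
    rw [map_inv, this]
    group

theorem inv_mul_mul_eq_of_braid {G : Type*} [Group G] {x y : G} (h : x * y * x = y * x * y) :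
    x⁻¹ * y * x = y * x * y⁻¹ := by
  rw [eq_mul_inv_iff_mul_eq, mul_assoc, mul_assoc, inv_mul_eq_iff_eq_mul, ← mul_assoc, ← h,
    ← mul_assoc]

namespace B4

theorem a_mul_b_mul_a : a * b * a = b * a * b :=
  PresentedGroup.mk_eq_mk_of_mul_inv_mem (rels := braidRels) (by simp [braidRels])

theorem b_mul_c_mul_b : b * c * b = c * b * c :=
  PresentedGroup.mk_eq_mk_of_mul_inv_mem (rels := braidRels) (by simp [braidRels])

theorem a_mul_c : a * c = c * a :=
  PresentedGroup.mk_eq_mk_of_mul_inv_mem (rels := braidRels) (by simp [braidRels])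

theorem closure_eq_top : Subgroup.closure {a, b, c} = (⊤ : Subgroup B4) := by
  rw [← PresentedGroup.closure_range_of]
  congr 1
  ext g
  simp [Fin.exists_fin_succ, a, b, c, eq_comm]

/-- The homomorphism out of `B4` determined by images of the generators satisfying the braid
relations. -/
def lift {G : Type*} [Group G] (α β γ : G) (hab : α * β * α = β * α * β)
    (hbc : β * γ * β = γ * β * γ) (hac : α * γ = γ * α) : B4 →* G :=
  PresentedGroup.toGroup (f := ![α, β, γ]) (by
    rintro r (rfl | rfl | rfl)
    · simp [hab]
    · simp [hbc]
    · simp [hac])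

section lift

variable {G : Type*} [Group G] (α β γ : G) (hab : α * β * α = β * α * β)
  (hbc : β * γ * β = γ * β * γ) (hac : α * γ = γ * α)

@[simp]
theorem lift_a : lift α β γ hab hbc hac a = α := PresentedGroup.toGroup.of _

@[simp]
theorem lift_b : lift α β γ hab hbc hac b = β := PresentedGroup.toGroup.of _

@[simp]
theorem lift_c : lift α β γ hab hbc hac c = γ := PresentedGroup.toGroup.of _

end lift

/-- The free group of rank two. -/
abbrev F2 := FreeGroup (Fin 2)

theorem mulAut_ext {σ τ : MulAut F2} (h₀ : σ (.of 0) = τ (.of 0)) (h₁ : σ (.of 1) = τ (.of 1)) :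
    σ = τ := by
  have h : σ.toMonoidHom = τ.toMonoidHom := by
    ext i
    fin_cases i
    · exact h₀
    · exact h₁
  ext w
  exact DFunLike.congr_fun h w

/-- Conjugation by `a` on the free group on `a * c⁻¹` and `b * (a * c⁻¹) * b⁻¹`. -/
def autA : MulAut F2 :=
  MonoidHom.toMulEquiv (FreeGroup.lift ![.of 0, .of 1 * (.of 0)⁻¹])
    (FreeGroup.lift ![.of 0, .of 1 * .of 0])
    (by ext i; fin_cases i <;> simp) (by ext i; fin_cases i <;> simp)

/-- Conjugation by `b` on the free group on `a * c⁻¹` and `b * (a * c⁻¹) * b⁻¹`. -/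
def autB : MulAut F2 :=
  MonoidHom.toMulEquiv (FreeGroup.lift ![.of 1, .of 1 * (.of 0)⁻¹ * .of 1])
    (FreeGroup.lift ![.of 0 * (.of 1)⁻¹ * .of 0, .of 0])
    (by ext i; fin_cases i <;> simp [mul_assoc]) (by ext i; fin_cases i <;> simp [mul_assoc])

/-- Conjugation by `c` on the free group on `a * c⁻¹` and `b * (a * c⁻¹) * b⁻¹`. -/
def autC : MulAut F2 :=
  MonoidHom.toMulEquiv (FreeGroup.lift ![.of 0, (.of 0)⁻¹ * .of 1])
    (FreeGroup.lift ![.of 0, .of 0 * .of 1])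
    (by ext i; fin_cases i <;> simp) (by ext i; fin_cases i <;> simp)

/-- Conjugation by `a` on the free group on `b * a⁻¹` and `a * (b * a⁻¹) * a⁻¹`. -/
def autS : MulAut F2 :=
  MonoidHom.toMulEquiv (FreeGroup.lift ![.of 1, (.of 0)⁻¹ * .of 1])
    (FreeGroup.lift ![.of 0 * (.of 1)⁻¹, .of 0])
    (by ext i; fin_cases i <;> simp) (by ext i; fin_cases i <;> simp)

@[simp]
theorem autA_of_zero : autA (.of 0) = .of 0 := rfl

@[simp]
theorem autA_of_one : autA (.of 1) = .of 1 * (.of 0)⁻¹ := rfl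

@[simp]
theorem autB_of_zero : autB (.of 0) = .of 1 := rfl

@[simp]
theorem autB_of_one : autB (.of 1) = .of 1 * (.of 0)⁻¹ * .of 1 := rfl

@[simp]
theorem autC_of_zero : autC (.of 0) = .of 0 := rfl

@[simp]
theorem autC_of_one : autC (.of 1) = (.of 0)⁻¹ * .of 1 := rfl

@[simp]
theorem autS_of_zero : autS (.of 0) = .of 1 := rfl

@[simp]
theorem autS_of_one : autS (.of 1) = (.of 0)⁻¹ * .of 1 := rfl

/-- The conjugation action of `B4` on the free group on `a * c⁻¹` and `b * (a * c⁻¹) * b⁻¹`. -/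
def actU : B4 →* MulAut F2 :=
  lift autA autB autC
    (by apply mulAut_ext <;> simp [mul_assoc])
    (by apply mulAut_ext <;> simp [mul_assoc])
    (by apply mulAut_ext <;> simp [mul_assoc])

/-- The action of `B4` on a free group of rank two for which `a` and `c` act alike, extending the
conjugation action of `⟨a, b⟩` on the free group on `b * a⁻¹` and `a * (b * a⁻¹) * a⁻¹`. -/
def actP : B4 →* MulAut F2 :=
  lift autS (MulAut.conj (.of 0) * autS) autS
    (by apply mulAut_ext <;> simp [mul_assoc])
    (by apply mulAut_ext <;> simp [mul_assoc])
    rfl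

/-- The inclusion of the free group on `a * c⁻¹` and `b * (a * c⁻¹) * b⁻¹`. -/
def inclU : F2 →* B4 := FreeGroup.lift ![a * c⁻¹, b * (a * c⁻¹) * b⁻¹]

/-- The inclusion of the free group on `b * a⁻¹` and `a * (b * a⁻¹) * a⁻¹`. -/
def inclP : F2 →* B4 := FreeGroup.lift ![b * a⁻¹, a * (b * a⁻¹) * a⁻¹]

/-- The exponent sum of a braid. -/
def expSum : B4 →* Multiplicative ℤ :=
  lift (.ofAdd 1) (.ofAdd 1) (.ofAdd 1) rfl rfl rfl

/-- The abelianization of the free group of rank two. -/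
def ab : F2 →* Multiplicative (ℤ × ℤ) := FreeGroup.lift ![.ofAdd (1, 0), .ofAdd (0, 1)]

theorem actU_inclU (w : F2) : actU (inclU w) = MulAut.conj w := by
  suffices h : actU.comp inclU = MulAut.conj from DFunLike.congr_fun h w
  ext1 i
  fin_cases i
  · simp only [inclU, actU, MonoidHom.comp_apply]
    simp [mul_inv_eq_iff_eq_mul]
    apply mulAut_ext <;> simp [mul_assoc]
  · simp only [inclU, actU, MonoidHom.comp_apply]
    simp [mul_inv_eq_iff_eq_mul, ← mul_assoc]
    apply mulAut_ext <;> simp [mul_assoc]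

theorem actP_inclU (w : F2) : actP (inclU w) = 1 := by
  suffices h : actP.comp inclU = 1 from DFunLike.congr_fun h w
  ext1 i
  fin_cases i <;> simp [inclU, actP]

theorem actP_inclP (w : F2) : actP (inclP w) = MulAut.conj w := by
  suffices h : actP.comp inclP = MulAut.conj from DFunLike.congr_fun h w
  ext1 i
  fin_cases i
  · simp [inclP, actP]
  · simp [inclP, actP, mul_inv_eq_iff_eq_mul]
    apply mulAut_ext <;> simp [mul_assoc]

theorem expSum_inclU (w : F2) : expSum (inclU w) = 1 := by
  suffices h : expSum.comp inclU = 1 from DFunLike.congr_fun h w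
  ext1 i
  fin_cases i <;> simp [inclU, expSum]

theorem expSum_inclP (w : F2) : expSum (inclP w) = 1 := by
  suffices h : expSum.comp inclP = 1 from DFunLike.congr_fun h w
  ext1 i
  fin_cases i <;> simp [inclP, expSum]

theorem expSum_x_pow_four : expSum (x ^ 4) = .ofAdd 12 := by
  simp only [x, expSum, map_pow, map_mul, lift_a, lift_b, lift_c]
  rfl

theorem ab_conj (w g : F2) : ab (w * g * w⁻¹) = ab g := by
  rw [map_mul, map_mul, map_inv, mul_right_comm, mul_inv_cancel, one_mul]

theorem inclU_actU (g : B4) (w : F2) : inclU (actU g w) = g * inclU w * g⁻¹ := by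
  have hca : c⁻¹ * a = a * c⁻¹ := by rw [inv_mul_eq_iff_eq_mul, ← mul_assoc, ← a_mul_c]; group
  have hab := inv_mul_mul_eq_of_braid a_mul_b_mul_a
  have hcb := congrArg (·⁻¹) (inv_mul_mul_eq_of_braid b_mul_c_mul_b.symm)
  have hbc := congrArg (·⁻¹) b_mul_c_mul_b
  simp only [mul_inv_rev, inv_inv] at hcb hbc
  refine map_apply_eq_conj_of_mem_closure (s := {a, b, c}) ?_ (closure_eq_top ▸ trivial) w
  rintro g (rfl | rfl | rfl) i <;> fin_cases i <;> simp [inclU, actU]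
  · rw [eq_mul_inv_iff_mul_eq, mul_assoc, hca]
  · calc _ = b * a * (c⁻¹ * (b⁻¹ * c)) * a⁻¹ := by group
      _ = (b * a * b) * c⁻¹ * b⁻¹ * a⁻¹ := by rw [hcb]; group
      _ = _ := by rw [← a_mul_b_mul_a]; group
  · calc _ = b * a * (c⁻¹ * (b⁻¹ * c)) * (a⁻¹ * b * a) * c⁻¹ * b⁻¹ := by group
      _ = b * (a * b * (c⁻¹ * a) * b⁻¹ * c⁻¹ * b⁻¹) := by rw [hcb, hab]; group
      _ = b * (a * b * a) * (c⁻¹ * (b⁻¹ * c⁻¹)) * b⁻¹ := by rw [hca]; group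
      _ = _ := by rw [← hbc, a_mul_b_mul_a]; group
  · rw [← mul_assoc, ← a_mul_c]
    group
  · calc _ = c * (a⁻¹ * b * a) * c⁻¹ * b⁻¹ := by group
      _ = c * b * a * (b⁻¹ * (c⁻¹ * b⁻¹)) := by rw [hab]; group
      _ = _ := by rw [hbc]; group

theorem inclP_actP_a_zpow (n : ℤ) (w : F2) :
    inclP (actP (a ^ n) w) = a ^ n * inclP w * (a ^ n)⁻¹ := by
  refine map_apply_eq_conj_of_mem_closure (s := {a}) ?_
    (Subgroup.zpow_mem _ (Subgroup.subset_closure (Set.mem_singleton a)) n) w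
  rintro g rfl i
  fin_cases i <;> simp [inclP, actP]
  calc _ = a * (b⁻¹ * a * b) * a⁻¹ * a⁻¹ := by group
    _ = _ := by rw [inv_mul_mul_eq_of_braid a_mul_b_mul_a.symm]; group

theorem exists_eq_inclU_mul_inclP_mul_zpow (g : B4) :
    ∃ (w v : F2) (n : ℤ), g = inclU w * inclP v * a ^ n := by
  have hg : g ∈ Subgroup.closure {a, b, c} := closure_eq_top ▸ trivial
  induction hg using Subgroup.closure_induction with
  | mem g hg =>
    obtain rfl | rfl | rfl := hg
    · exact ⟨1, 1, 1, by simp⟩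
    · exact ⟨1, .of 0, 1, by simp [inclP]⟩
    · exact ⟨(.of 0)⁻¹, 1, 1, by simp [inclU]⟩
  | one => exact ⟨1, 1, 0, by simp⟩
  | mul g k _ _ hg hk =>
    obtain ⟨w, v, n, rfl⟩ := hg
    obtain ⟨w', v', m, rfl⟩ := hk
    refine ⟨w * actU (inclP v * a ^ n) w', v * actP (a ^ n) v', n + m, ?_⟩
    rw [map_mul inclU, map_mul inclP, inclU_actU, inclP_actP_a_zpow]
    group
  | inv g _ hg =>
    obtain ⟨w, v, n, rfl⟩ := hg
    refine ⟨actU (a ^ (-n) * inclP v⁻¹) w⁻¹, actP (a ^ (-n)) v⁻¹, -n, ?_⟩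
    rw [inclU_actU, inclP_actP_a_zpow, map_inv, map_inv]
    group

theorem a_mul_x_sq : a * x ^ 2 = x ^ 2 * c :=
  calc a * x ^ 2 = (a * b * a) * c * b * a * c := by rw [x, sq]; group
    _ = b * a * (b * c * b) * a * c := by rw [a_mul_b_mul_a]; group
    _ = b * a * c * b * (c * a) * c := by rw [b_mul_c_mul_b]; group
    _ = x ^ 2 * c := by rw [← a_mul_c, x, sq]; group

theorem c_mul_x_sq : c * x ^ 2 = x ^ 2 * a :=
  calc c * x ^ 2 = c * b * (a * c) * b * a * c := by rw [x, sq]; group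
    _ = (c * b * c) * a * b * a * c := by rw [a_mul_c]; group
    _ = b * c * (b * a * b) * a * c := by rw [← b_mul_c_mul_b]; group
    _ = b * (c * a) * b * a * (a * c) := by rw [← a_mul_b_mul_a]; group
    _ = b * (a * c) * b * a * (c * a) := by rw [a_mul_c]
    _ = x ^ 2 * a := by rw [x, sq]; group

theorem b_mul_x_sq : b * x ^ 2 = x ^ 2 * b :=
  calc b * x ^ 2 = b * (b * (a * c) * b * a * c) := by rw [x, sq]; group
    _ = b * b * c * (a * b * a) * c := by rw [a_mul_c]; group
    _ = b * (b * c * b) * a * b * c := by rw [a_mul_b_mul_a]; group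
    _ = b * (c * b * c) * a * b * c := by rw [b_mul_c_mul_b]
    _ = b * c * b * (c * a) * b * c := by group
    _ = b * c * b * a * (c * b * c) := by rw [← a_mul_c]; group
    _ = b * c * (b * a * b) * c * b := by rw [← b_mul_c_mul_b]; group
    _ = b * (c * a) * b * (a * c) * b := by rw [← a_mul_b_mul_a]; group
    _ = x ^ 2 * b := by rw [← a_mul_c, x, sq]; group

theorem x_pow_four_mem_center : x ^ 4 ∈ Subgroup.center B4 := by
  have hx : x ^ 4 = x ^ 2 * x ^ 2 := by group
  have h : Subgroup.closure {a, b, c} ≤ Subgroup.centralizer {x ^ 4} := by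
    rw [Subgroup.closure_le]
    rintro g (rfl | rfl | rfl) <;> rw [SetLike.mem_coe, Subgroup.mem_centralizer_singleton_iff, hx]
    · rw [← mul_assoc, a_mul_x_sq, mul_assoc, c_mul_x_sq, mul_assoc]
    · rw [← mul_assoc, b_mul_x_sq, mul_assoc, b_mul_x_sq, mul_assoc]
    · rw [← mul_assoc, c_mul_x_sq, mul_assoc, a_mul_x_sq, mul_assoc]
  rw [closure_eq_top] at h
  exact Subgroup.mem_center_iff.2 fun g =>
    Subgroup.mem_centralizer_singleton_iff.1 (h (Subgroup.mem_top g))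

theorem exists_inclP_mul_a_pow_six : ∃ v, inclP v * a ^ (6 : ℤ) = (a * b) ^ 3 := by
  refine ⟨actP (a ^ (1 : ℤ)) (.of 0) * actP (a ^ (3 : ℤ)) (.of 0) * actP (a ^ (5 : ℤ)) (.of 0), ?_⟩
  rw [map_mul, map_mul, inclP_actP_a_zpow, inclP_actP_a_zpow, inclP_actP_a_zpow]
  simp only [inclP, FreeGroup.lift_apply_of, Matrix.cons_val_zero, pow_succ, pow_zero, one_mul]
  group

theorem actP_a_mul_b_pow_three : actP ((a * b) ^ 3) = 1 := by
  simp only [actP, map_pow, map_mul, lift_a, lift_b]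
  apply mulAut_ext <;> simp [pow_succ, mul_assoc]

theorem eq_one_of_mem_center {z : B4} (hz : z ∈ Subgroup.center B4) {r : ℕ} (hr : r < 12)
    (hzr : expSum z = .ofAdd (r : ℤ)) : z = 1 := by
  obtain ⟨w, v, n, rfl⟩ := exists_eq_inclU_mul_inclP_mul_zpow z
  obtain rfl : n = r := by
    rw [map_mul, map_mul, expSum_inclU, expSum_inclP, map_zpow] at hzr
    simpa [expSum, ← ofAdd_zsmul] using hzr
  have hU := map_eq_one_of_mem_center FreeGroup.center_eq_bot actU_inclU hz
  have hP := map_eq_one_of_mem_center FreeGroup.center_eq_bot actP_inclP hz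
  rw [map_mul, map_mul, actP_inclU, actP_inclP, one_mul] at hP
  have hr6 : r = 0 ∨ r = 6 := by
    have h := congrArg ab (DFunLike.congr_fun hP (.of 0))
    rw [MulAut.mul_apply, MulAut.conj_apply, ab_conj, zpow_natCast, map_pow, actP, lift_a] at h
    interval_cases r <;> simp [pow_succ, ab, ← ofAdd_neg, ← ofAdd_add] at h ⊢
  obtain rfl | rfl := hr6
  · have hv : v = 1 := MulAut.conj_injective_of_center_eq_bot FreeGroup.center_eq_bot
      (by simpa using hP)
    subst hv
    have hw : w = 1 := MulAut.conj_injective_of_center_eq_bot FreeGroup.center_eq_bot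
      (by simpa [actU_inclU] using hU)
    simp [hw]
  · obtain ⟨v', hv'⟩ := exists_inclP_mul_a_pow_six
    have hP' := congrArg actP hv'
    rw [map_mul, actP_inclP, actP_a_mul_b_pow_three] at hP'
    obtain rfl : v = v' := MulAut.conj_injective_of_center_eq_bot FreeGroup.center_eq_bot
      (mul_right_cancel (hP.trans hP'.symm))
    rw [mul_assoc, Nat.cast_ofNat, hv', map_mul, actU_inclU] at hU
    have h := congrArg ab (DFunLike.congr_fun hU (.of 0))
    rw [MulAut.mul_apply, MulAut.conj_apply, ab_conj] at h
    simp [actU, pow_succ, ab, ← ofAdd_neg, ← ofAdd_add] at h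

end B4

theorem statement5 :
    Subgroup.center B4 = Subgroup.zpowers (x ^ 4) ∧ ¬ IsOfFinOrder (x ^ 4) := by
  constructor
  · apply le_antisymm
    · intro z hz
      have key : z * ((x ^ 4) ^ ((expSum z).toAdd / 12))⁻¹ = 1 := by
        refine eq_one_of_mem_center (Subgroup.mul_mem _ hz (Subgroup.inv_mem _
          (Subgroup.zpow_mem _ x_pow_four_mem_center _))) (r := ((expSum z).toAdd % 12).toNat)
          (by omega) ?_
        apply Multiplicative.toAdd.injective
        rw [map_mul, map_inv, map_zpow, expSum_x_pow_four]
        simp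
        omega
      exact ⟨_, (mul_inv_eq_one.1 key).symm⟩
    · simpa using x_pow_four_mem_center
  · intro h
    have := expSum.isOfFinOrder h
    rw [expSum_x_pow_four, isOfFinOrder_iff_pow_eq_one] at this
    obtain ⟨n, hn, h⟩ := this
    have h' := congrArg Multiplicative.toAdd h
    simp at h'
    omega
end

section
/- The automorphism group of the free group of rank two is isomorphic to the automorphism group of the universal Coxeter group of rank three: Aut(F₂) ≅ Aut(W₃), where W₃ = ⟨r, s, t | r² = s² = t² = 1⟩. -/
/-- Relators for the universal Coxeter group `W₃ = ⟨r, s, t | r² = s² = t² = 1⟩`,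
with generators indexed `0 ↦ r`, `1 ↦ s`, `2 ↦ t`. -/
def cox3Rels : Set (FreeGroup (Fin 3)) := { w | ∃ i : Fin 3, w = FreeGroup.of i ^ 2 }

/-- The universal Coxeter group of rank 3. -/
abbrev W3 := PresentedGroup cox3Rels

namespace W3

def r : W3 := PresentedGroup.of 0
def s : W3 := PresentedGroup.of 1
def t : W3 := PresentedGroup.of 2

/-- The parity homomorphism `W₃ → ℤ/2ℤ` sending each of `r`, `s`, `t` to `1`. -/
def parity : W3 →* Multiplicative (ZMod 2) :=
  PresentedGroup.toGroup (f := fun _ => Multiplicative.ofAdd 1)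
    (by rintro w ⟨i, rfl⟩; simp [map_pow]; decide)

/-- The subgroup of even-length elements of `W₃`. -/
def E : Subgroup W3 := parity.ker

end W3

open W3

namespace W3

/-- The involution of `F₂` inverting both generators. -/
def invGens : FreeGroup (Fin 2) →* FreeGroup (Fin 2) :=
  FreeGroup.lift fun i => (FreeGroup.of i)⁻¹

/-- Sanov's faithful representation of `F₂` by integer matrices. -/
def sanov : FreeGroup (Fin 2) →* (Matrix (Fin 2) (Fin 2) ℤ)ˣ :=
  FreeGroup.lift ![
    ⟨!![1, 2; 0, 1], !![1, -2; 0, 1], by simp [Matrix.one_fin_two], by simp [Matrix.one_fin_two]⟩,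
    ⟨!![1, 0; 2, 1], !![1, 0; -2, 1], by simp [Matrix.one_fin_two], by simp [Matrix.one_fin_two]⟩]

/-- The matrix `diag(1, -1)`, conjugation by which inverts both Sanov generators. -/
def reflection : (Matrix (Fin 2) (Fin 2) ℤ)ˣ :=
  ⟨!![1, 0; 0, -1], !![1, 0; 0, -1], by simp [Matrix.one_fin_two], by simp [Matrix.one_fin_two]⟩

lemma reflection_mul_self : reflection * reflection = 1 := by
  ext1
  simp [reflection, Matrix.one_fin_two]

@[simp] lemma sanov_zero : (sanov (FreeGroup.of 0)).val = !![1, 2; 0, 1] := by simp [sanov]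

@[simp] lemma sanov_one : (sanov (FreeGroup.of 1)).val = !![1, 0; 2, 1] := by simp [sanov]

@[simp] lemma sanov_inv_zero : (sanov (FreeGroup.of 0))⁻¹.val = !![1, -2; 0, 1] := by
  simp [sanov, -Matrix.coe_units_inv]

@[simp] lemma sanov_inv_one : (sanov (FreeGroup.of 1))⁻¹.val = !![1, 0; -2, 1] := by
  simp [sanov, -Matrix.coe_units_inv]

lemma first_column_ne_zero (M : (Matrix (Fin 2) (Fin 2) ℤ)ˣ) : M.val 0 0 ≠ 0 ∨ M.val 1 0 ≠ 0 := by
  by_contra! h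
  have := (Matrix.isUnit_iff_isUnit_det M.val).1 M.isUnit
  simp [Matrix.det_fin_two, h] at this

theorem sanov_injective : Function.Injective sanov := by
  refine FreeGroup.injective_lift_of_ping_pong (α := (Matrix (Fin 2) (Fin 2) ℤ)ˣ) _
    (X := ![{M | M.val 1 0 = 0 ∨ 0 < M.val 1 0 ∧ M.val 1 0 ≤ M.val 0 0 ∨
        M.val 1 0 < 0 ∧ M.val 0 0 ≤ M.val 1 0},
      {M | 0 < M.val 1 0 ∧ 0 ≤ M.val 0 0 ∧ M.val 0 0 < M.val 1 0 ∨
        M.val 1 0 < 0 ∧ M.val 0 0 ≤ 0 ∧ M.val 1 0 < M.val 0 0}])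
    (Y := ![{M | 0 < M.val 1 0 ∧ M.val 0 0 < - M.val 1 0 ∨
        M.val 1 0 < 0 ∧ - M.val 1 0 < M.val 0 0},
      {M | 0 < M.val 1 0 ∧ M.val 0 0 < 0 ∧ - M.val 1 0 ≤ M.val 0 0 ∨
        M.val 1 0 < 0 ∧ 0 < M.val 0 0 ∧ M.val 0 0 ≤ - M.val 1 0}]) ?_ ?_ ?_ ?_ ?_ ?_
  · intro i
    fin_cases i
    · exact ⟨1, by simp⟩
    · exact ⟨Units.mk !![0, 1; 1, 0] !![0, 1; 1, 0] (by simp [Matrix.one_fin_two])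
        (by simp [Matrix.one_fin_two]), by simp⟩
  · intro i j hij
    rw [Function.onFun, Set.disjoint_left]
    intro M
    fin_cases i <;> fin_cases j <;> simp at hij ⊢ <;> omega
  · intro i j hij
    rw [Function.onFun, Set.disjoint_left]
    intro M
    fin_cases i <;> fin_cases j <;> simp at hij ⊢ <;> omega
  · intro i j
    rw [Set.disjoint_left]
    intro M
    fin_cases i <;> fin_cases j <;> simp <;> omega
  · rintro i _ ⟨M, hM, rfl⟩
    have := first_column_ne_zero M
    fin_cases i <;> simp [Matrix.mul_apply] at hM ⊢ <;> omega
  · rintro i _ ⟨M, hM, rfl⟩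
    have := first_column_ne_zero M
    fin_cases i <;> simp [Matrix.mul_apply, -Matrix.coe_units_inv] at hM ⊢ <;> omega

/-- The congruence conditions cutting out the image of `sanov`. -/
def IsSanov (M : Matrix (Fin 2) (Fin 2) ℤ) : Prop :=
  M.det = 1 ∧ ∃ p q u v : ℤ, M = !![1 + 4 * p, 2 * q; 2 * u, 1 + 4 * v]

lemma IsSanov.mul {M N : Matrix (Fin 2) (Fin 2) ℤ} (hM : IsSanov M) (hN : IsSanov N) :
    IsSanov (M * N) := by
  obtain ⟨hM, p, q, u, v, rfl⟩ := hM
  obtain ⟨hN, p', q', u', v', rfl⟩ := hN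
  refine ⟨by rw [Matrix.det_mul, hM, hN, one_mul], p + p' + 4 * p * p' + q * u',
    q' + q + 4 * p * q' + 4 * q * v', u + u' + 4 * u * p' + 4 * v * u',
    v + v' + 4 * v * v' + u * q', ?_⟩
  simp only [Matrix.mul_fin_two]
  ext i j; fin_cases i <;> fin_cases j <;> simp <;> ring

lemma isSanov_sanov (g : FreeGroup (Fin 2)) : IsSanov (sanov g).val := by
  induction g using FreeGroup.induction_on with
  | C1 => exact ⟨by simp, 0, 0, 0, 0, by simp [Matrix.one_fin_two]⟩
  | of i =>
    fin_cases i
    · exact ⟨by simp [Matrix.det_fin_two], 0, 1, 0, 0, by simp [-Matrix.coe_units_inv]⟩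
    · exact ⟨by simp [Matrix.det_fin_two], 0, 0, 1, 0, by simp [-Matrix.coe_units_inv]⟩
  | inv_of i _ =>
    fin_cases i
    · exact ⟨by simp [Matrix.det_fin_two, -Matrix.coe_units_inv], 0, -1, 0, 0,
        by simp [-Matrix.coe_units_inv]⟩
    · exact ⟨by simp [Matrix.det_fin_two, -Matrix.coe_units_inv], 0, 0, -1, 0,
        by simp [-Matrix.coe_units_inv]⟩
  | mul g h hg hh => simpa using hg.mul hh

lemma sanov_zero_zpow (n : ℤ) : (sanov (FreeGroup.of 0 ^ n)).val = !![1, 2 * n; 0, 1] := by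
  induction n using Int.induction_on with
  | zero => simp [Matrix.one_fin_two]
  | succ n ih =>
    rw [zpow_add_one, map_mul, Units.val_mul, ih, sanov_zero]
    simp [mul_add, add_comm]
  | pred n ih =>
    rw [zpow_sub_one, map_mul, Units.val_mul, ih, map_inv, sanov_inv_zero]
    simp [mul_sub]; ring

theorem exists_sanov_eq {M : Matrix (Fin 2) (Fin 2) ℤ} (hM : IsSanov M) :
    ∃ g, (sanov g).val = M := by
  induction h : (M 0 0).natAbs + (M 1 0).natAbs using Nat.strong_induction_on generalizing M with
  | _ n ih =>
  have step (g : FreeGroup (Fin 2))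
      (hlt : (((sanov g).val * M) 0 0).natAbs + (((sanov g).val * M) 1 0).natAbs < n) :
      ∃ g, (sanov g).val = M := by
    obtain ⟨k, hk⟩ := ih _ hlt ((isSanov_sanov g).mul hM) rfl
    exact ⟨g⁻¹ * k, by rw [map_mul, Units.val_mul, hk, map_inv, Units.inv_mul_cancel_left]⟩
  obtain ⟨hdet, p, q, u, v, rfl⟩ := hM
  simp only [Matrix.det_fin_two_of] at hdet
  simp at h
  by_cases hu : u = 0
  · subst hu
    have hp : 1 + 4 * p = 1 := by
      have hpv : (1 + 4 * p) * (1 + 4 * v) = 1 := by linarith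
      rcases Int.isUnit_iff.1 (IsUnit.of_mul_eq_one _ hpv) with h | h <;> omega
    have hv : 1 + 4 * v = 1 := by rw [hp] at hdet; linarith
    exact ⟨_, by rw [sanov_zero_zpow q, hp, hv]; simp⟩
  by_cases hlt : (2 * u).natAbs < (1 + 4 * p).natAbs
  · by_cases hs : 0 < u ↔ 0 < 1 + 4 * p
    · exact step (FreeGroup.of 0)⁻¹ (by simp [-Matrix.coe_units_inv]; omega)
    · exact step (FreeGroup.of 0) (by simp [-Matrix.coe_units_inv]; omega)
  · by_cases hs : 0 < u ↔ 0 < 1 + 4 * p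
    · exact step (FreeGroup.of 1)⁻¹ (by simp [-Matrix.coe_units_inv]; omega)
    · exact step (FreeGroup.of 1) (by simp [-Matrix.coe_units_inv]; omega)

lemma reflection_mul_sanov (g : FreeGroup (Fin 2)) :
    reflection * sanov g = sanov (invGens g) * reflection := by
  have h : (MulAut.conj reflection).toMonoidHom.comp sanov = sanov.comp invGens := by
    ext i : 1
    fin_cases i <;> ext a b <;> fin_cases a <;> fin_cases b <;>
      simp [invGens, reflection, -Matrix.coe_units_inv]
  have := DFunLike.congr_fun h g
  simp only [MonoidHom.comp_apply, MulEquiv.coe_toMonoidHom, MulAut.conj_apply] at this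
  rw [← this]; group

lemma eq_one_of_forall_commute {g : FreeGroup (Fin 2)} (h : ∀ k, g * k = k * g) : g = 1 := by
  apply sanov_injective
  obtain ⟨hdet, p, q, u, v, hM⟩ := isSanov_sanov g
  have key (i) := congr_arg (fun k => (sanov k).val) (h (FreeGroup.of i))
  have h0 := key 0
  have h1 := key 1
  simp only [map_mul, Units.val_mul, hM, sanov_zero, sanov_one] at h0 h1
  rw [hM] at hdet
  simp [Matrix.det_fin_two_of] at h0 h1 hdet
  have hu : u = 0 := by omega
  have hq : q = 0 := by omega
  subst hu hq
  have hv : v = p := by omega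
  subst hv
  have hp : v * (1 + 2 * v) = 0 := by linarith
  have hp : v = 0 := by
    rcases mul_eq_zero.1 hp with h | h <;> omega
  ext1
  simp [hM, hp, Matrix.one_fin_two]

lemma commutator_mem_of_closure {G R : Type*} [Group G] [Ring R] (ρ : G →* Rˣ) {S : Set G}
    (hS : Subgroup.closure S = ⊤) (L : Ideal R) (hL : ∀ k, ∀ x ∈ L, x * (ρ k).val ∈ L)
    (h : ∀ a ∈ S, ∀ b ∈ S, (ρ a).val * (ρ b).val - (ρ b).val * (ρ a).val ∈ L) (k l : G) :
    (ρ k).val * (ρ l).val - (ρ l).val * (ρ k).val ∈ L := by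
  have symm {a b : G} (hab : (ρ a).val * (ρ b).val - (ρ b).val * (ρ a).val ∈ L) :
      (ρ b).val * (ρ a).val - (ρ a).val * (ρ b).val ∈ L := by
    rw [← neg_sub]; exact L.neg_mem hab
  have extend (a : G) (ha : ∀ b ∈ S, (ρ a).val * (ρ b).val - (ρ b).val * (ρ a).val ∈ L) (b : G) :
      (ρ a).val * (ρ b).val - (ρ b).val * (ρ a).val ∈ L := by
    have hb : b ∈ Subgroup.closure S := hS ▸ Subgroup.mem_top b
    induction hb using Subgroup.closure_induction with
    | mem b hb => exact ha b hb
    | one => simp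
    | mul b c _ _ hb hc =>
      convert L.add_mem (hL c _ hb) (L.mul_mem_left (ρ b).val hc) using 1
      simp only [map_mul, Units.val_mul]
      noncomm_ring
    | inv b _ hb =>
      convert L.neg_mem (L.mul_mem_left (ρ b⁻¹).val (hL b⁻¹ _ hb)) using 1
      simp [mul_sub, sub_mul, mul_assoc]
  exact extend k (fun b hb => symm (extend b (h b hb) k)) l

lemma mul_commutator_mul (A B : Matrix (Fin 2) (Fin 2) ℤ) :
    A * (A * B - B * A) * A = A.det • (A * B - B * A) := by
  ext i j
  fin_cases i <;> fin_cases j <;>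
    simp [Matrix.mul_apply, Matrix.det_fin_two, Fin.sum_univ_two] <;> ring

/-- The commutator of any generating pair is a right divisor of that of the Sanov generators. -/
lemma exists_mul_commutator_eq {a : Fin 2 → FreeGroup (Fin 2)}
    (ha : Subgroup.closure (Set.range a) = ⊤) :
    ∃ M : Matrix (Fin 2) (Fin 2) ℤ,
      M * ((sanov (a 0)).val * (sanov (a 1)).val - (sanov (a 1)).val * (sanov (a 0)).val) =
        !![4, 0; 0, -4] := by
  set J := (sanov (a 0)).val * (sanov (a 1)).val - (sanov (a 1)).val * (sanov (a 0)).val with hJ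
  have hJa (i : Fin 2) : J * (sanov (a i)).val = (sanov (a i)⁻¹).val * J := by
    rw [map_inv, Units.eq_inv_mul_iff_mul_eq, ← mul_assoc]
    fin_cases i
    · exact (mul_commutator_mul _ _).trans (by rw [(isSanov_sanov _).1, one_smul, hJ]; rfl)
    · have := mul_commutator_mul (sanov (a 1)).val (sanov (a 0)).val
      rw [(isSanov_sanov _).1, one_smul, ← neg_sub, ← hJ] at this
      simpa using this
  have hJk (k : FreeGroup (Fin 2)) : ∃ k', J * (sanov k).val = (sanov k').val * J := by
    have hk : k ∈ Subgroup.closure (Set.range a) := ha ▸ Subgroup.mem_top k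
    induction hk using Subgroup.closure_induction with
    | mem k hk => obtain ⟨i, rfl⟩ := hk; exact ⟨_, hJa i⟩
    | one => exact ⟨1, by simp⟩
    | mul k l _ _ hk hl =>
      obtain ⟨k', hk⟩ := hk
      obtain ⟨l', hl⟩ := hl
      exact ⟨k' * l', by simp only [map_mul, Units.val_mul, ← mul_assoc, hk]
                         simp only [mul_assoc, hl]⟩
    | inv k _ hk =>
      obtain ⟨k', hk⟩ := hk
      refine ⟨k'⁻¹, ?_⟩
      rw [map_inv, map_inv, Units.eq_inv_mul_iff_mul_eq, ← mul_assoc, ← hk, mul_assoc,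
        Units.mul_inv, mul_one]
  have := commutator_mem_of_closure sanov ha (Ideal.span {J}) ?_ ?_
    (FreeGroup.of 0) (FreeGroup.of 1)
  · obtain ⟨M, hM⟩ := Ideal.mem_span_singleton'.1 this
    refine ⟨M, hM.trans ?_⟩
    rw [sanov_zero, sanov_one]
    ext i j
    fin_cases i <;> fin_cases j <;> simp
  · intro k x hx
    obtain ⟨M, rfl⟩ := Ideal.mem_span_singleton'.1 hx
    obtain ⟨k', hk⟩ := hJk k
    rw [mul_assoc, hk, ← mul_assoc]
    exact Ideal.mul_mem_left _ _ (Ideal.mem_span_singleton_self J)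
  · have hmem := Ideal.mem_span_singleton_self J
    rintro _ ⟨i, rfl⟩ _ ⟨j, rfl⟩
    fin_cases i <;> fin_cases j
    · simp
    · exact hmem
    · rw [← neg_sub]; exact neg_mem hmem
    · simp

lemma closure_range_map_of (α : MulAut (FreeGroup (Fin 2))) :
    Subgroup.closure (Set.range fun i => α (FreeGroup.of i)) = ⊤ := by
  have := MonoidHom.map_closure α.toMonoidHom (Set.range FreeGroup.of)
  rw [FreeGroup.closure_range_of, ← Set.range_comp] at this
  exact this.symm.trans (Subgroup.map_top_of_surjective _ α.surjective)

/-- A generating pair of `F₂` is inverted by a reflection in the coset of `reflection`. -/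
lemma exists_reflection_inverting {a : Fin 2 → FreeGroup (Fin 2)}
    (ha : Subgroup.closure (Set.range a) = ⊤) :
    ∃ w, (sanov w * reflection) * (sanov w * reflection) = 1 ∧
      ∀ i, sanov (a i) * (sanov w * reflection) * sanov (a i) = sanov w * reflection := by
  obtain ⟨M, hM⟩ := exists_mul_commutator_eq ha
  have hinv0 := mul_commutator_mul (sanov (a 0)).val (sanov (a 1)).val
  have hinv1 := mul_commutator_mul (sanov (a 1)).val (sanov (a 0)).val
  obtain ⟨hd0, p, q, u, v, h0⟩ := isSanov_sanov (a 0)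
  obtain ⟨hd1, p', q', u', v', h1⟩ := isSanov_sanov (a 1)
  rw [hd0, one_smul] at hinv0
  rw [hd1, one_smul, ← neg_sub] at hinv1
  obtain ⟨k, m, n, hK⟩ : ∃ k m n : ℤ,
      (sanov (a 0)).val * (sanov (a 1)).val - (sanov (a 1)).val * (sanov (a 0)).val =
        (4 : ℤ) • !![k, 2 * m; 2 * n, -k] := by
    refine ⟨q * u' - q' * u, p * q' + q * v' - p' * q - q' * v,
      u * p' + v * u' - u' * p - v' * u, ?_⟩
    rw [h0, h1]
    ext i j
    fin_cases i <;> fin_cases j <;> simp <;> ring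
  rw [hK] at hM hinv0 hinv1
  have hMK : M * !![k, 2 * m; 2 * n, -k] = !![1, 0; 0, -1] := by
    rw [Matrix.mul_smul] at hM
    refine smul_right_injective _ (four_ne_zero : (4 : ℤ) ≠ 0) (hM.trans ?_)
    simp
  have hinv0 : (sanov (a 0)).val * !![k, 2 * m; 2 * n, -k] * (sanov (a 0)).val =
      !![k, 2 * m; 2 * n, -k] := by
    refine smul_right_injective _ (four_ne_zero : (4 : ℤ) ≠ 0) ?_
    simpa only [Matrix.mul_smul, Matrix.smul_mul] using hinv0
  have hinv1 : (sanov (a 1)).val * !![k, 2 * m; 2 * n, -k] * (sanov (a 1)).val =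
      !![k, 2 * m; 2 * n, -k] := by
    refine smul_right_injective _ (four_ne_zero : (4 : ℤ) ≠ 0) (neg_injective ?_)
    simpa only [Matrix.mul_smul, Matrix.smul_mul, Matrix.mul_neg, Matrix.neg_mul] using hinv1
  have hinv (i) : (sanov (a i)).val * !![k, 2 * m; 2 * n, -k] * (sanov (a i)).val =
      !![k, 2 * m; 2 * n, -k] := by
    fin_cases i
    exacts [hinv0, hinv1]
  have hdet : IsUnit (-(k * k) - 4 * (m * n)) := by
    refine IsUnit.of_mul_eq_one (-M.det) ?_
    have := congr_arg Matrix.det hMK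
    simp only [Matrix.det_mul, Matrix.det_fin_two_of] at this
    linarith
  have hodd : k * k + 4 * (m * n) = 1 ∧ ∃ l, k = 1 + 2 * l := by
    obtain ⟨l, rfl | rfl⟩ : ∃ l, k = 2 * l ∨ k = 1 + 2 * l := ⟨k / 2, by omega⟩
    · rw [show -(2 * l * (2 * l)) - 4 * (m * n) = 4 * (-(l * l) - m * n) by ring] at hdet
      rcases Int.isUnit_iff.1 hdet with h | h <;> omega
    · refine ⟨?_, l, rfl⟩
      have : (1 + 2 * l) * (1 + 2 * l) = 1 + 4 * (l + l * l) := by ring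
      rw [this] at hdet ⊢
      rcases Int.isUnit_iff.1 hdet with h | h <;> omega
  obtain ⟨hk, l, rfl⟩ := hodd
  have hsq : !![1 + 2 * l, 2 * m; 2 * n, -(1 + 2 * l)] * !![1 + 2 * l, 2 * m; 2 * n, -(1 + 2 * l)]
      = 1 := by
    rw [Matrix.one_fin_two]
    ext i j
    fin_cases i <;> fin_cases j <;> simp <;> linarith
  obtain ⟨w, hw⟩ : ∃ w, (sanov w * reflection).val = !![1 + 2 * l, 2 * m; 2 * n, -(1 + 2 * l)] ∨
      (sanov w * reflection).val = -!![1 + 2 * l, 2 * m; 2 * n, -(1 + 2 * l)] := by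
    obtain ⟨c, rfl | rfl⟩ : ∃ c, l = 2 * c ∨ l = -1 - 2 * c :=
      ⟨if 2 ∣ l then l / 2 else (-1 - l) / 2, by split_ifs <;> omega⟩
    · obtain ⟨w, hw⟩ := exists_sanov_eq (M := !![1 + 4 * c, 2 * (-m); 2 * n, 1 + 4 * c])
        ⟨by rw [Matrix.det_fin_two_of]; linarith, _, _, _, _, rfl⟩
      refine ⟨w, .inl ?_⟩
      rw [Units.val_mul, hw]
      simp [reflection]
      omega
    · obtain ⟨w, hw⟩ := exists_sanov_eq (M := !![1 + 4 * c, 2 * m; 2 * (-n), 1 + 4 * c])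
        ⟨by rw [Matrix.det_fin_two_of]; linarith, _, _, _, _, rfl⟩
      refine ⟨w, .inr ?_⟩
      rw [Units.val_mul, hw]
      simp [reflection]
      omega
  refine ⟨w, Units.ext ?_, fun i => Units.ext ?_⟩
  · rw [Units.val_mul, Units.val_one]
    rcases hw with hw | hw <;> simp only [hw, neg_mul_neg, hsq]
  · rw [Units.val_mul, Units.val_mul (sanov (a i))]
    rcases hw with hw | hw <;> simp only [hw, mul_neg, neg_mul, hinv]

theorem exists_conj_invGens (α : MulAut (FreeGroup (Fin 2))) :
    ∃ w, w * invGens w = 1 ∧ ∀ g, α (invGens g) = w * invGens (α g) * w⁻¹ := by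
  obtain ⟨w, hsq, hinv⟩ := exists_reflection_inverting (closure_range_map_of α)
  refine ⟨w, sanov_injective ?_, fun g => ?_⟩
  · rw [map_mul, map_one, ← hsq, mul_assoc, ← mul_assoc reflection, reflection_mul_sanov, mul_assoc,
      reflection_mul_self, mul_one]
  · have h : α.toMonoidHom.comp invGens =
        ((MulAut.conj w).toMonoidHom.comp invGens).comp α.toMonoidHom := by
      ext i : 1
      apply sanov_injective
      simp only [MonoidHom.comp_apply, MulEquiv.coe_toMonoidHom, MulAut.conj_apply, invGens,
        FreeGroup.lift_apply_of]
      rw [← invGens, map_inv, map_inv, map_mul, map_mul, map_inv, inv_eq_iff_mul_eq_one]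
      have := reflection_mul_sanov (α (FreeGroup.of i))
      rw [← mul_inv_eq_iff_eq_mul] at this
      rw [← this]
      have := hinv i
      rw [← mul_inv_eq_one] at this
      rw [← this]
      group
    exact DFunLike.congr_fun h g

lemma of_mul_self (i : Fin 3) : (PresentedGroup.of i : W3) * PresentedGroup.of i = 1 := by
  rw [← pow_two]
  exact PresentedGroup.one_of_mem (rels := cox3Rels) ⟨i, rfl⟩

lemma s_mul_s : s * s = 1 := of_mul_self 1

/-- The homomorphism `W₃ → G` determined by a triple of involutions. -/
def liftInvolutions {G : Type*} [Group G] (f : Fin 3 → G) (hf : ∀ i, f i * f i = 1) : W3 →* G :=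
  PresentedGroup.toGroup (f := f) (by rintro w ⟨i, rfl⟩; simp [pow_two, hf])

lemma liftInvolutions_of {G : Type*} [Group G] (f : Fin 3 → G) (hf : ∀ i, f i * f i = 1)
    (i : Fin 3) : liftInvolutions f hf (PresentedGroup.of i) = f i :=
  PresentedGroup.toGroup.of _

/-- The embedding of `F₂` in `W₃` with image the even-length elements. -/
def evenEmbedding : FreeGroup (Fin 2) →* W3 := FreeGroup.lift ![r * s, s * t]

lemma s_mul_evenEmbedding (g : FreeGroup (Fin 2)) :
    s * evenEmbedding g = evenEmbedding (invGens g) * s := by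
  have hs : s⁻¹ = s := inv_eq_of_mul_eq_one_left s_mul_s
  have hr : r⁻¹ = r := inv_eq_of_mul_eq_one_left (of_mul_self 0)
  have ht : t⁻¹ = t := inv_eq_of_mul_eq_one_left (of_mul_self 2)
  have h : (MulAut.conj s).toMonoidHom.comp evenEmbedding = evenEmbedding.comp invGens := by
    ext i : 1
    fin_cases i
    · simp [evenEmbedding, invGens, hs, hr, mul_assoc, s_mul_s]
    · simp [evenEmbedding, invGens, hs, ht, ← mul_assoc, s_mul_s]
  have := DFunLike.congr_fun h g
  simp only [MonoidHom.comp_apply, MulEquiv.coe_toMonoidHom, MulAut.conj_apply] at this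
  rw [← this, inv_mul_cancel_right]

lemma r_eq : r = evenEmbedding (FreeGroup.of 0) * s := by
  simp [evenEmbedding, mul_assoc, s_mul_s]

lemma t_eq : t = evenEmbedding (FreeGroup.of 1)⁻¹ * s := by
  have := s_mul_evenEmbedding (FreeGroup.of 1)
  simpa [invGens, evenEmbedding, ← mul_assoc, s_mul_s] using this

lemma exists_evenEmbedding (w : W3) : ∃ g, w = evenEmbedding g ∨ w = evenEmbedding g * s := by
  have hw : w ∈ Subgroup.closure (Set.range (PresentedGroup.of (rels := cox3Rels))) := by
    rw [PresentedGroup.closure_range_of]; trivial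
  have hmul (g : FreeGroup (Fin 2)) (w : W3)
      (h : ∃ g, w = evenEmbedding g ∨ w = evenEmbedding g * s) :
      ∃ k, evenEmbedding g * s * w = evenEmbedding k ∨
        evenEmbedding g * s * w = evenEmbedding k * s := by
    obtain ⟨k, rfl | rfl⟩ := h
    · exact ⟨g * invGens k, .inr (by rw [mul_assoc, s_mul_evenEmbedding, map_mul, mul_assoc])⟩
    · refine ⟨g * invGens k, .inl ?_⟩
      rw [mul_assoc, ← mul_assoc s, s_mul_evenEmbedding, map_mul, mul_assoc (evenEmbedding _) s,
        s_mul_s, mul_one]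
  have hof (i : Fin 3) : ∃ g, PresentedGroup.of i = evenEmbedding g * s := by
    fin_cases i
    exacts [⟨_, r_eq⟩, ⟨1, by simp [s]⟩, ⟨_, t_eq⟩]
  induction hw using Subgroup.closure_induction_left with
  | one => exact ⟨1, .inl (map_one _).symm⟩
  | mul_left x hx y _ ih =>
    obtain ⟨i, rfl⟩ := hx
    obtain ⟨g, hg⟩ := hof i
    exact hg ▸ hmul g y ih
  | inv_mul_cancel x hx y _ ih =>
    obtain ⟨i, rfl⟩ := hx
    obtain ⟨g, hg⟩ := hof i
    rw [inv_eq_of_mul_eq_one_left (of_mul_self i)]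
    exact hg ▸ hmul g y ih

theorem evenEmbedding_injective : Function.Injective evenEmbedding := by
  have hr := reflection_mul_self
  have h0 := reflection_mul_sanov (FreeGroup.of 0)
  have h1 := reflection_mul_sanov (FreeGroup.of 1)
  let φ := liftInvolutions
    ![sanov (FreeGroup.of 0) * reflection, reflection, reflection * sanov (FreeGroup.of 1)] <| by
      intro i
      fin_cases i
      · change _ * reflection * (_ * reflection) = 1
        rw [mul_assoc, ← mul_assoc reflection, h0, mul_assoc, hr]
        simp [invGens]
      · exact hr
      · change reflection * _ * (reflection * _) = 1
        nth_rw 1 [h1]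
        rw [mul_assoc, ← mul_assoc reflection, hr]
        simp [invGens]
  have h : φ.comp evenEmbedding = sanov := by
    ext i : 1
    fin_cases i
    · simp [φ, evenEmbedding, r, s, liftInvolutions_of, mul_assoc, hr]
    · simp [φ, evenEmbedding, s, t, liftInvolutions_of, ← mul_assoc, hr]
  refine Function.Injective.of_comp (f := φ) ?_
  rw [← MonoidHom.coe_comp, h]
  exact sanov_injective

lemma parity_of (i : Fin 3) : parity (PresentedGroup.of i) = Multiplicative.ofAdd 1 :=
  PresentedGroup.toGroup.of _

lemma parity_evenEmbedding (g : FreeGroup (Fin 2)) : parity (evenEmbedding g) = 1 := by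
  have h : parity.comp evenEmbedding = 1 := by
    ext i : 1
    fin_cases i <;> simp [evenEmbedding, r, s, t, parity_of] <;> decide
  exact DFunLike.congr_fun h g

lemma parity_eq_one_iff {w : W3} : parity w = 1 ↔ ∃ g, evenEmbedding g = w := by
  refine ⟨fun h => ?_, fun ⟨g, hg⟩ => hg ▸ parity_evenEmbedding g⟩
  obtain ⟨g, rfl | rfl⟩ := exists_evenEmbedding w
  · exact ⟨g, rfl⟩
  · rw [map_mul, parity_evenEmbedding, one_mul, s, parity_of] at h
    exact absurd h (by decide)

lemma evenEmbedding_ne_mul_s (g k : FreeGroup (Fin 2)) : evenEmbedding g ≠ evenEmbedding k * s := by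
  intro h
  have := congr_arg parity h
  rw [map_mul, parity_evenEmbedding, parity_evenEmbedding, one_mul, s, parity_of] at this
  exact absurd this (by decide)

lemma parity_of_mul_self_eq_one {w : W3} (hw : w * w = 1) (hne : w ≠ 1) :
    parity w = Multiplicative.ofAdd 1 := by
  obtain ⟨g, rfl | rfl⟩ := exists_evenEmbedding w
  · rw [← map_mul, ← map_one evenEmbedding, evenEmbedding_injective.eq_iff, ← pow_two,
      pow_eq_one_iff_left two_ne_zero] at hw
    exact absurd (hw ▸ map_one _) hne
  · rw [map_mul, parity_evenEmbedding, one_mul, s, parity_of]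

lemma parity_comp_mulAut (φ : MulAut W3) (w : W3) : parity (φ w) = parity w := by
  have h : parity.comp φ.toMonoidHom = parity := by
    refine PresentedGroup.ext fun i => ?_
    rw [parity_of]
    refine parity_of_mul_self_eq_one (w := φ _) (by rw [← map_mul, of_mul_self, map_one]) ?_
    rw [Ne, EmbeddingLike.map_eq_one_iff]
    intro hi
    have := parity_of i
    rw [hi, map_one] at this
    exact absurd this (by decide)
  exact DFunLike.congr_fun h w

lemma exists_restriction (φ : MulAut W3) :
    ∃ α : MulAut (FreeGroup (Fin 2)), ∀ g, evenEmbedding (α g) = φ (evenEmbedding g) := by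
  have h (φ : MulAut W3) (g) : ∃ k, evenEmbedding k = φ (evenEmbedding g) := by
    rw [← parity_eq_one_iff, parity_comp_mulAut, parity_evenEmbedding]
  choose f hf using h
  refine ⟨MulEquiv.mk' ⟨f φ, f φ⁻¹, fun g => ?_, fun g => ?_⟩ fun g k => ?_, hf φ⟩
  all_goals apply evenEmbedding_injective
  · simp [hf]
  · simp [hf]
  · simp [hf]

lemma exists_extension (α : MulAut (FreeGroup (Fin 2))) :
    ∃ φ : MulAut W3, ∀ g, φ (evenEmbedding g) = evenEmbedding (α g) := by
  obtain ⟨w, hw, hα⟩ := exists_conj_invGens α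
  have hsq (g : FreeGroup (Fin 2)) (hg : g * invGens g = 1) :
      evenEmbedding (α g * w) * s * (evenEmbedding (α g * w) * s) = 1 := by
    rw [mul_assoc, ← mul_assoc s, s_mul_evenEmbedding, mul_assoc, s_mul_s, mul_one, ← map_mul]
    have : invGens (α g) = w⁻¹ * α (invGens g) * w := by rw [hα]; group
    rw [map_mul invGens, this]
    have : α g * w * (w⁻¹ * α (invGens g) * w * invGens w) = 1 := by
      rw [mul_assoc _ w (invGens w), hw, mul_one, mul_assoc, mul_inv_cancel_left, ← map_mul, hg,
        map_one]
    rw [this, map_one]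
  let φ := liftInvolutions ![evenEmbedding (α (FreeGroup.of 0) * w) * s,
    evenEmbedding (α 1 * w) * s, evenEmbedding (α (FreeGroup.of 1)⁻¹ * w) * s] <| by
      intro i
      fin_cases i <;> exact hsq _ (by simp [invGens])
  have hs : φ s = evenEmbedding w * s := by
    simp [φ, s, liftInvolutions_of]
  have hφ (g) : φ (evenEmbedding g) = evenEmbedding (α g) := by
    have h : φ.comp evenEmbedding = evenEmbedding.comp α.toMonoidHom := by
      have h1 := hsq 1 (by simp)
      rw [map_one, one_mul] at h1
      ext i : 1
      fin_cases i
      · have : evenEmbedding (FreeGroup.of 0) = r * s := by simp [evenEmbedding]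
        simp only [MonoidHom.comp_apply, Fin.zero_eta, this, map_mul, hs]
        simp [φ, r, liftInvolutions_of, mul_assoc]
        simpa [mul_assoc] using h1
      · have : evenEmbedding (FreeGroup.of 1) = s * t := by simp [evenEmbedding]
        have h2 := hsq (FreeGroup.of 1)⁻¹ (by simp [invGens])
        simp only [MonoidHom.comp_apply, Fin.mk_one, this, map_mul, hs]
        simp only [map_mul, map_inv, mul_assoc, inv_mul_eq_one] at h2
        simpa [φ, t, liftInvolutions_of, mul_assoc] using h2.symm
    exact DFunLike.congr_fun h g
  refine ⟨MulEquiv.ofBijective φ ⟨(injective_iff_map_eq_one φ).2 fun a ha => ?_, fun a => ?_⟩, hφ⟩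
  · obtain ⟨g, rfl | rfl⟩ := exists_evenEmbedding a
    · rw [hφ, ← map_one evenEmbedding, evenEmbedding_injective.eq_iff,
        EmbeddingLike.map_eq_one_iff] at ha
      rw [ha, map_one]
    · rw [map_mul, hφ, hs, ← mul_assoc, ← map_mul, ← map_one evenEmbedding] at ha
      exact absurd ha.symm (evenEmbedding_ne_mul_s _ _)
  · obtain ⟨g, rfl | rfl⟩ := exists_evenEmbedding a
    · exact ⟨evenEmbedding (α.symm g), by simp [hφ]⟩
    · exact ⟨evenEmbedding (α.symm (g * w⁻¹)) * s, by
        rw [map_mul, hφ, hs, MulEquiv.apply_symm_apply, ← mul_assoc, ← map_mul,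
          inv_mul_cancel_right]⟩

lemma eq_one_of_fixes_evenEmbedding {φ : MulAut W3}
    (h : ∀ g, φ (evenEmbedding g) = evenEmbedding g) : φ = 1 := by
  have hs : φ s = s := by
    obtain ⟨u, hu | hu⟩ := exists_evenEmbedding (φ s)
    · rw [← h, φ.injective.eq_iff] at hu
      exact absurd (by rw [← hu, map_one, one_mul]) (evenEmbedding_ne_mul_s u 1)
    · suffices u = 1 by rw [hu, this, map_one, one_mul]
      have hinv (g) : invGens (invGens g) = g := by
        have : invGens.comp invGens = MonoidHom.id _ := by ext; simp [invGens]
        exact DFunLike.congr_fun this g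
      refine eq_one_of_forall_commute fun k => evenEmbedding_injective ?_
      have := congr_arg φ (s_mul_evenEmbedding (invGens k))
      rw [map_mul, map_mul, h, h, hu, mul_assoc, s_mul_evenEmbedding, hinv, ← mul_assoc,
        ← mul_assoc, mul_left_inj] at this
      rw [map_mul, map_mul, this]
  have : φ.toMonoidHom = MonoidHom.id W3 := by
    refine PresentedGroup.ext fun i => ?_
    fin_cases i
    · change φ r = r
      rw [r_eq, map_mul, h, hs]
    · exact hs
    · change φ t = t
      rw [t_eq, map_mul, h, hs]
  exact MulEquiv.ext fun w => DFunLike.congr_fun this w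

end W3

theorem statement18 : Nonempty (MulAut (FreeGroup (Fin 2)) ≃* MulAut W3) := by
  choose f hf using exists_restriction
  let F : MulAut W3 →* MulAut (FreeGroup (Fin 2)) := MonoidHom.mk' f fun φ ψ =>
    MulEquiv.ext fun g => evenEmbedding_injective (by simp [hf])
  refine ⟨(MulEquiv.ofBijective F
    ⟨(injective_iff_map_eq_one F).2 fun φ hφ => ?_, fun α => ?_⟩).symm⟩
  · refine eq_one_of_fixes_evenEmbedding fun g => ?_
    rw [← hf, show f φ = 1 from hφ, MulAut.one_apply]
  · obtain ⟨φ, hφ⟩ := exists_extension α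
    exact ⟨φ, MulEquiv.ext fun g => evenEmbedding_injective ((hf φ g).trans (hφ g))⟩
end
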